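/- arXiv:2210.08683 — 2 statements merged into one kernel-verified Lean document; each statement's English description precedes it below -/
import Mathlib

section
/- For every natural number n, the moment sequence satisfies n!/(2ⁿ · 8) ≤ η_n ≤ n!. -/
open MeasureTheory

/-- The moment sequence of the Hörmander-Fock space. -/
noncomputable def eta (n : ℕ) : ℝ :=
  ∫ t in Set.Ioi (0 : ℝ), t ^ n / (1 + t) ^ 2 * Real.exp (-t)

theorem integrableOn_pow_mul_exp_neg (n : ℕ) :
    IntegrableOn (fun t : ℝ => t ^ n * Real.exp (-t)) (Set.Ioi 0) := by
  have h := Real.GammaIntegral_convergent (s := n + 1) (by positivity)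
  refine h.congr_fun (fun t _ => ?_) measurableSet_Ioi
  simp [mul_comm]

theorem integral_pow_mul_exp_neg_mul_Ioi (n : ℕ) {r : ℝ} (hr : 0 < r) :
    ∫ t in Set.Ioi (0 : ℝ), t ^ n * Real.exp (-(r * t)) = n.factorial / r ^ (n + 1) := by
  have h := Real.integral_rpow_mul_exp_neg_mul_Ioi (a := n + 1) (by positivity) hr
  rw [Real.Gamma_nat_eq_factorial] at h
  have hpow : (1 / r) ^ ((n : ℝ) + 1) = 1 / r ^ (n + 1) := by
    rw [← one_div_pow]
    exact_mod_cast Real.rpow_natCast (1 / r) (n + 1)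
  rw [hpow] at h
  simpa [div_eq_inv_mul] using h

theorem eta_integrand_le (n : ℕ) {t : ℝ} (ht : 0 < t) :
    t ^ n / (1 + t) ^ 2 * Real.exp (-t) ≤ t ^ n * Real.exp (-t) := by
  gcongr
  exact div_le_self (by positivity) (one_le_pow₀ (by linarith))

theorem integrableOn_eta_integrand (n : ℕ) :
    IntegrableOn (fun t : ℝ => t ^ n / (1 + t) ^ 2 * Real.exp (-t)) (Set.Ioi 0) := by
  refine (integrableOn_pow_mul_exp_neg n).mono'
    (Measurable.aestronglyMeasurable (by fun_prop)) ?_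
  filter_upwards [ae_restrict_mem measurableSet_Ioi] with t ht
  have ht' : 0 < t := ht
  rw [Real.norm_of_nonneg (by positivity)]
  exact eta_integrand_le n ht'

theorem one_add_sq_le_four_mul_exp {t : ℝ} (ht : 0 ≤ t) : (1 + t) ^ 2 ≤ 4 * Real.exp t := by
  have h : 1 + t ≤ 2 * Real.exp (t / 2) := by linarith [Real.add_one_le_exp (t / 2)]
  calc (1 + t) ^ 2 ≤ (2 * Real.exp (t / 2)) ^ 2 := by gcongr
    _ = 4 * Real.exp t := by
      rw [mul_pow, ← Real.exp_nat_mul]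
      norm_num [mul_div_cancel₀]

theorem le_eta_integrand (n : ℕ) {t : ℝ} (ht : 0 < t) :
    1 / 4 * (t ^ n * Real.exp (-(2 * t))) ≤ t ^ n / (1 + t) ^ 2 * Real.exp (-t) := by
  have h : Real.exp (-t) / 4 ≤ 1 / (1 + t) ^ 2 := by
    rw [Real.exp_neg, ← one_div, div_div, mul_comm]
    exact one_div_le_one_div_of_le (by positivity) (one_add_sq_le_four_mul_exp ht.le)
  calc 1 / 4 * (t ^ n * Real.exp (-(2 * t)))
      = t ^ n * Real.exp (-t) * (Real.exp (-t) / 4) := by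
        rw [show -(2 * t) = -t + -t by ring, Real.exp_add]; ring
    _ ≤ t ^ n * Real.exp (-t) * (1 / (1 + t) ^ 2) := by gcongr
    _ = t ^ n / (1 + t) ^ 2 * Real.exp (-t) := by ring

theorem stmt_2 (n : ℕ) :
    (n.factorial : ℝ) / (2 ^ n * 8) ≤ eta n ∧ eta n ≤ n.factorial := by
  constructor
  · calc (n.factorial : ℝ) / (2 ^ n * 8)
        = ∫ t in Set.Ioi (0 : ℝ), 1 / 4 * (t ^ n * Real.exp (-(2 * t))) := by
          rw [integral_const_mul, integral_pow_mul_exp_neg_mul_Ioi n two_pos]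
          field_simp
          ring
      _ ≤ eta n := by
          refine integral_mono_of_nonneg ?_ (integrableOn_eta_integrand n) ?_
          all_goals filter_upwards [ae_restrict_mem measurableSet_Ioi] with t ht
          · have ht' : 0 < t := ht
            simp only [Pi.zero_apply]
            positivity
          · exact le_eta_integrand n ht
  · calc eta n ≤ ∫ t in Set.Ioi (0 : ℝ), t ^ n * Real.exp (-t) :=
          setIntegral_mono_on (integrableOn_eta_integrand n) (integrableOn_pow_mul_exp_neg n)
            measurableSet_Ioi fun t ht => eta_integrand_le n ht
      _ = n.factorial := by simpa using integral_pow_mul_exp_neg_mul_Ioi n one_pos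
end

section
/- For every natural number n, ∫₁^∞ (u-1)ⁿ u^{-1} e^{-u} du = n! · E_{n+1}(1), where E_{n+1}(1) = ∫₁^∞ e^{-t} t^{-(n+1)} dt. -/
open MeasureTheory

theorem integral_Ioi_sub_pow_mul_exp_neg_mul (n : ℕ) (a : ℝ) {t : ℝ} (ht : 0 < t) :
    ∫ u in Set.Ioi a, (u - a) ^ n * Real.exp (-(t * u)) =
      n.factorial * (Real.exp (-(t * a)) / t ^ (n + 1)) := by
  have hshift := (measurePreserving_sub_right volume a).setIntegral_preimage_emb
    (measurableEmbedding_subRight a)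
    (fun s : ℝ => s ^ n * Real.exp (-(t * s))) (Set.Ioi 0)
  have hpre : (fun x : ℝ => x - a) ⁻¹' Set.Ioi 0 = Set.Ioi a := by
    ext x
    simp
  have hgamma := Real.integral_rpow_mul_exp_neg_mul_Ioi (a := n + 1) (by positivity) ht
  simp only [add_sub_cancel_right, Real.rpow_natCast, Real.Gamma_nat_eq_factorial] at hgamma
  rw [hpre, hgamma] at hshift
  calc ∫ u in Set.Ioi a, (u - a) ^ n * Real.exp (-(t * u))
      = ∫ u in Set.Ioi a,
          (u - a) ^ n * Real.exp (-(t * (u - a))) * Real.exp (-(t * a)) := by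
        congr 1 with u
        rw [mul_assoc, ← Real.exp_add]
        ring_nf
    _ = _ := by
        rw [integral_mul_const, hshift, ← Nat.cast_succ, Real.rpow_natCast, Nat.succ_eq_add_one]
        simp only [one_div, inv_pow]
        ring

theorem integrableOn_Ioi_sub_pow_mul_exp_neg_mul (n : ℕ) (a : ℝ) {t : ℝ} (ht : 0 < t) :
    IntegrableOn (fun u : ℝ => (u - a) ^ n * Real.exp (-(t * u))) (Set.Ioi a) :=
  .of_integral_ne_zero (by
    rw [integral_Ioi_sub_pow_mul_exp_neg_mul n a ht]
    positivity)

theorem integrable_sub_one_pow_mul_exp_neg_mul_prod (n : ℕ) :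
    Integrable (Function.uncurry fun u t : ℝ => (u - 1) ^ n * Real.exp (-(t * u)))
      ((volume.restrict (Set.Ioi 1)).prod (volume.restrict (Set.Ioi 1))) := by
  have hu := integrableOn_Ioi_sub_pow_mul_exp_neg_mul n 1 one_pos
  have ht := integrableOn_Ioi_sub_pow_mul_exp_neg_mul 0 1 one_pos
  refine ((hu.mul_prod ht).mul_const (Real.exp 1)).mono'
    (Continuous.aestronglyMeasurable (by fun_prop)) ?_
  rw [Measure.prod_restrict]
  filter_upwards [ae_restrict_mem (measurableSet_Ioi.prod measurableSet_Ioi)]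
    with ⟨u, t⟩ ⟨hu1, ht1⟩
  simp only [Set.mem_Ioi] at hu1 ht1
  have hu0 : 0 ≤ u - 1 := by linarith
  simp only [Function.uncurry_apply_pair, pow_zero, one_mul]
  rw [Real.norm_of_nonneg (by positivity), mul_assoc, mul_assoc, ← Real.exp_add,
    ← Real.exp_add]
  gcongr
  nlinarith

theorem stmt_7 (n : ℕ) :
    ∫ u in Set.Ioi (1 : ℝ), (u - 1) ^ n / u * Real.exp (-u) =
      (n.factorial : ℝ) * ∫ t in Set.Ioi (1 : ℝ), Real.exp (-t) / t ^ (n + 1) := by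
  calc ∫ u in Set.Ioi (1 : ℝ), (u - 1) ^ n / u * Real.exp (-u)
      = ∫ u in Set.Ioi (1 : ℝ), ∫ t in Set.Ioi (1 : ℝ),
          (u - 1) ^ n * Real.exp (-(t * u)) := by
        refine setIntegral_congr_fun measurableSet_Ioi fun u hu => ?_
        have h := integral_Ioi_sub_pow_mul_exp_neg_mul 0 1 (zero_lt_one.trans hu)
        simp only [pow_zero, one_mul, Nat.factorial_zero, Nat.cast_one, zero_add,
          pow_one, mul_comm u] at h
        simp only [integral_const_mul, h]
        ring
    _ = ∫ t in Set.Ioi (1 : ℝ), ∫ u in Set.Ioi (1 : ℝ),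
          (u - 1) ^ n * Real.exp (-(t * u)) :=
        integral_integral_swap (integrable_sub_one_pow_mul_exp_neg_mul_prod n)
    _ = ∫ t in Set.Ioi (1 : ℝ), n.factorial * (Real.exp (-t) / t ^ (n + 1)) := by
        refine setIntegral_congr_fun measurableSet_Ioi fun t ht => ?_
        simpa only [mul_one] using
          integral_Ioi_sub_pow_mul_exp_neg_mul n 1 (zero_lt_one.trans ht)
    _ = _ := integral_const_mul _ _
end
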